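/- arXiv:1405.1971 — 7 statements merged into one kernel-verified Lean document; each statement's English description precedes it below -/
import Mathlib

section
/- Let M be the 4×4 real matrix M = [[1/4,1/4,1/2,0],[1/16,5/16,5/8,0],[3/32,7/32,7/16,1/4],[1/8,1/8,1/4,1/2]] and let π = (1/9, 2/9, 4/9, 2/9). For every row vector v in Fin 4 → ℝ with nonnegative entries summing to 1, the sequence of row vectors v·Mⁿ converges to π as n → ∞. -/
open Matrix Filter

/-- Transition matrix of the Markov chain of algorithm states. -/
noncomputable def M : Matrix (Fin 4) (Fin 4) ℝ :=
  !![1/4, 1/4, 1/2, 0;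
     1/16, 5/16, 5/8, 0;
     3/32, 7/32, 7/16, 1/4;
     1/8, 1/8, 1/4, 1/2]

/-- Stationary distribution. -/
noncomputable def pi' : Fin 4 → ℝ := ![1/9, 2/9, 4/9, 2/9]

/-- A matrix with unit row sums preserves the total mass of row vectors. -/
lemma sum_vecMul_of_row_sum_one {n : Type*} [Fintype n] {P : Matrix n n ℝ}
    (hP : ∀ i, ∑ j, P i j = 1) (u : n → ℝ) : ∑ j, (u ᵥ* P) j = ∑ i, u i := by
  simp only [vecMul, dotProduct]
  rw [Finset.sum_comm]
  simp [← Finset.mul_sum, hP]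

/-- Doeblin's contraction estimate: if every row of `P` dominates `c`, then `P` contracts the
`ℓ¹`-norm on row vectors of total mass zero by the factor `1 - ∑ j, c j`. -/
lemma sum_abs_vecMul_le {n : Type*} [Fintype n] {P : Matrix n n ℝ} {c : n → ℝ}
    (hP : ∀ i, ∑ j, P i j = 1) (hc : ∀ i j, c j ≤ P i j) {u : n → ℝ} (hu : ∑ i, u i = 0) :
    ∑ j, |(u ᵥ* P) j| ≤ (1 - ∑ j, c j) * ∑ i, |u i| := by
  have h (j : n) : (u ᵥ* P) j = ∑ i, u i * (P i j - c j) := by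
    simp [vecMul, dotProduct, mul_sub, Finset.sum_sub_distrib, ← Finset.sum_mul, hu]
  calc ∑ j, |(u ᵥ* P) j| ≤ ∑ j, ∑ i, |u i| * (P i j - c j) := by
        refine Finset.sum_le_sum fun j _ => ?_
        rw [h]
        refine (Finset.abs_sum_le_sum_abs _ _).trans_eq (Finset.sum_congr rfl fun i _ => ?_)
        rw [abs_mul, abs_of_nonneg (sub_nonneg.2 (hc i j))]
    _ = (1 - ∑ j, c j) * ∑ i, |u i| := by
        rw [Finset.sum_comm, mul_comm, Finset.sum_mul]
        simp [← Finset.mul_sum, Finset.sum_sub_distrib, hP]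

/-- Convergence to the stationary distribution under Doeblin's minorization condition. -/
lemma tendsto_vecMul_pow_of_minorization {n : Type*} [Fintype n] [DecidableEq n]
    {P : Matrix n n ℝ} {c p v : n → ℝ} (hP : ∀ i, ∑ j, P i j = 1) (hc : ∀ i j, c j ≤ P i j)
    (hc_pos : 0 < ∑ j, c j) (hc_le : ∑ j, c j ≤ 1) (hp : p ᵥ* P = p)
    (hv : ∑ i, v i = ∑ i, p i) :
    Tendsto (fun k : ℕ => v ᵥ* P ^ k) atTop (nhds p) := by
  have hstat (k : ℕ) : p ᵥ* P ^ k = p := by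
    induction k with
    | zero => simp
    | succ k ih => rw [pow_succ, ← vecMul_vecMul, ih, hp]
  have hsum (k : ℕ) : ∑ i, ((v - p) ᵥ* P ^ k) i = 0 := by
    induction k with
    | zero => simp [hv]
    | succ k ih => rw [pow_succ, ← vecMul_vecMul, sum_vecMul_of_row_sum_one hP, ih]
  have hbound (k : ℕ) :
      ∑ i, |((v - p) ᵥ* P ^ k) i| ≤ (1 - ∑ j, c j) ^ k * ∑ i, |(v - p) i| := by
    induction k with
    | zero => simp
    | succ k ih =>
      rw [pow_succ, ← vecMul_vecMul, pow_succ', mul_assoc]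
      exact (sum_abs_vecMul_le hP hc (hsum k)).trans
        (mul_le_mul_of_nonneg_left ih (sub_nonneg.2 hc_le))
  have hlim : Tendsto (fun k : ℕ => (1 - ∑ j, c j) ^ k * ∑ i, |(v - p) i|) atTop (nhds 0) := by
    simpa using (tendsto_pow_atTop_nhds_zero_of_lt_one (sub_nonneg.2 hc_le)
      (sub_lt_self 1 hc_pos)).mul_const (∑ i, |(v - p) i|)
  refine tendsto_pi_nhds.2 fun j => tendsto_iff_dist_tendsto_zero.2 ?_
  refine squeeze_zero (fun _ => dist_nonneg) (fun k => ?_) hlim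
  refine le_trans ?_ (hbound k)
  have hj : dist ((v ᵥ* P ^ k) j) (p j) = |((v - p) ᵥ* P ^ k) j| := by
    rw [Real.dist_eq, sub_vecMul, hstat, Pi.sub_apply]
  rw [hj]
  exact Finset.single_le_sum (f := fun i => |((v - p) ᵥ* P ^ k) i|)
    (fun i _ => abs_nonneg _) (Finset.mem_univ j)

theorem stmt2 (v : Fin 4 → ℝ) (hv_nonneg : ∀ i, 0 ≤ v i)
    (hv_sum : ∑ i : Fin 4, v i = 1) :
    Tendsto (fun n : ℕ => v ᵥ* (M ^ n)) atTop (nhds pi') := by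
  refine tendsto_vecMul_pow_of_minorization (c := ![1/16, 1/8, 1/4, 0]) ?_ ?_ ?_ ?_ ?_ ?_
  · intro i
    fin_cases i <;> norm_num [M, Fin.sum_univ_succ]
  · intro i j
    fin_cases i <;> fin_cases j <;> norm_num [M]
  · norm_num [Fin.sum_univ_succ]
  · norm_num [Fin.sum_univ_succ]
  · ext j
    fin_cases j <;> norm_num [M, pi', vecMul, dotProduct, Fin.sum_univ_succ]
  · rw [hv_sum]
    norm_num [pi', Fin.sum_univ_succ]
end

section
/- Let M be the 4×4 real matrix M = [[1/4,1/4,1/2,0],[1/16,5/16,5/8,0],[3/32,7/32,7/16,1/4],[1/8,1/8,1/4,1/2]] and let π = (1/9, 2/9, 4/9, 2/9). For every row vector v in Fin 4 → ℝ with nonnegative entries summing to 1, the Cesàro averages (1/n)·Σ_{k=0}^{n−1} v·Mᵏ converge to π as n → ∞; in particular, the sum of the first three coordinates of (1/n)·Σ_{k=0}^{n−1} v·Mᵏ converges to 7/9. -/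
open Matrix Filter

lemma vecMul_M_apply (u : Fin 4 → ℝ) :
    (u ᵥ* M) 0 = u 0 / 4 + u 1 / 16 + 3 * u 2 / 32 + u 3 / 8 ∧
    (u ᵥ* M) 1 = u 0 / 4 + 5 * u 1 / 16 + 7 * u 2 / 32 + u 3 / 8 ∧
    (u ᵥ* M) 2 = u 0 / 2 + 5 * u 1 / 8 + 7 * u 2 / 16 + u 3 / 4 ∧
    (u ᵥ* M) 3 = u 2 / 4 + u 3 / 2 := by
  refine ⟨?_, ?_, ?_, ?_⟩ <;>
    simp [M, Matrix.vecMul, dotProduct, Fin.sum_univ_four] <;> ring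

/-- The powers of `M` preserve the probability simplex. -/
lemma vecMul_M_pow_mem_stdSimplex {v : Fin 4 → ℝ} (hv : v ∈ stdSimplex ℝ (Fin 4)) (k : ℕ) :
    v ᵥ* M ^ k ∈ stdSimplex ℝ (Fin 4) := by
  induction k with
  | zero => simpa using hv
  | succ k ih =>
    rw [pow_succ, ← Matrix.vecMul_vecMul]
    generalize v ᵥ* M ^ k = u at ih
    obtain ⟨hu, hs⟩ := ih
    obtain ⟨h0, h1, h2, h3⟩ := vecMul_M_apply u
    rw [Fin.sum_univ_four] at hs
    have u0 := hu 0
    have u1 := hu 1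
    have u2 := hu 2
    have u3 := hu 3
    refine ⟨fun i => ?_, ?_⟩
    · fin_cases i <;> simp only [Fin.zero_eta, Fin.mk_one, Fin.reduceFinMk] <;> linarith
    · rw [Fin.sum_univ_four]
      linarith

lemma sum_vecMul_M_pow_telescope (v : Fin 4 → ℝ) (n : ℕ) :
    (∑ k ∈ Finset.range n, v ᵥ* M ^ k) + v ᵥ* M ^ n =
      v + (∑ k ∈ Finset.range n, v ᵥ* M ^ k) ᵥ* M := by
  rw [← Finset.sum_range_succ, Finset.sum_range_succ', Matrix.sum_vecMul, add_comm]
  simp [pow_succ, Matrix.vecMul_vecMul]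

/-- The partial sums of `v ᵥ* M ^ k` stay at bounded distance from `n • pi'`. -/
lemma abs_sum_vecMul_M_pow_sub_le {v : Fin 4 → ℝ} (hv : v ∈ stdSimplex ℝ (Fin 4)) (n : ℕ)
    (i : Fin 4) :
    |(∑ k ∈ Finset.range n, v ᵥ* M ^ k) i - n * pi' i| ≤ 100 := by
  have hsum : ∑ j, (∑ k ∈ Finset.range n, v ᵥ* M ^ k) j = n := by
    simp only [Finset.sum_apply]
    rw [Finset.sum_comm]
    simp [(vecMul_M_pow_mem_stdSimplex hv _).2]
  have htel := sum_vecMul_M_pow_telescope v n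
  have hw := vecMul_M_pow_mem_stdSimplex hv n
  generalize v ᵥ* M ^ n = w at hw htel
  generalize (∑ k ∈ Finset.range n, v ᵥ* M ^ k) = S at hsum htel ⊢
  obtain ⟨h0, h1, h2, h3⟩ := vecMul_M_apply S
  have t0 := congrFun htel 0
  have t1 := congrFun htel 1
  have t2 := congrFun htel 2
  have t3 := congrFun htel 3
  simp only [Pi.add_apply] at t0 t1 t2 t3
  rw [Fin.sum_univ_four] at hsum
  have bv (j) : 0 ≤ v j ∧ v j ≤ 1 := mem_Icc_of_mem_stdSimplex hv j
  have bw (j) : 0 ≤ w j ∧ w j ≤ 1 := mem_Icc_of_mem_stdSimplex hw j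
  obtain ⟨v0, v0'⟩ := bv 0
  obtain ⟨v1, v1'⟩ := bv 1
  obtain ⟨v2, v2'⟩ := bv 2
  obtain ⟨v3, v3'⟩ := bv 3
  obtain ⟨w0, w0'⟩ := bw 0
  obtain ⟨w1, w1'⟩ := bw 1
  obtain ⟨w2, w2'⟩ := bw 2
  obtain ⟨w3, w3'⟩ := bw 3
  rw [abs_le]
  fin_cases i <;> simp [pi'] <;> constructor <;> linarith

lemma tendsto_one_div_mul_of_abs_sub_le {s : ℕ → ℝ} {a C : ℝ}
    (h : ∀ n : ℕ, |s n - n * a| ≤ C) :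
    Tendsto (fun n : ℕ => 1 / (n : ℝ) * s n) atTop (nhds a) := by
  rw [tendsto_iff_norm_sub_tendsto_zero]
  refine squeeze_zero' (Eventually.of_forall fun n => norm_nonneg _) ?_
    (tendsto_const_div_atTop_nhds_zero_nat C)
  filter_upwards [eventually_gt_atTop 0] with n hn
  have hn' : (0 : ℝ) < n := Nat.cast_pos.2 hn
  have he : 1 / (n : ℝ) * s n - a = (s n - n * a) / n := by
    field_simp
  rw [he, Real.norm_eq_abs, abs_div, abs_of_pos hn']
  exact div_le_div_of_nonneg_right (h n) hn'.le

theorem stmt5 (v : Fin 4 → ℝ) (hv_nonneg : ∀ i, 0 ≤ v i)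
    (hv_sum : ∑ i : Fin 4, v i = 1) :
    Tendsto (fun n : ℕ => (1 / (n : ℝ)) • ∑ k ∈ Finset.range n, v ᵥ* (M ^ k))
      atTop (nhds pi') ∧
    Tendsto (fun n : ℕ =>
        ((1 / (n : ℝ)) • ∑ k ∈ Finset.range n, v ᵥ* (M ^ k)) 0 +
        ((1 / (n : ℝ)) • ∑ k ∈ Finset.range n, v ᵥ* (M ^ k)) 1 +
        ((1 / (n : ℝ)) • ∑ k ∈ Finset.range n, v ᵥ* (M ^ k)) 2)
      atTop (nhds (7 / 9)) := by
  have key : Tendsto (fun n : ℕ => (1 / (n : ℝ)) • ∑ k ∈ Finset.range n, v ᵥ* (M ^ k))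
      atTop (nhds pi') :=
    tendsto_pi_nhds.2 fun i => tendsto_one_div_mul_of_abs_sub_le fun n =>
      abs_sum_vecMul_M_pow_sub_le ⟨hv_nonneg, hv_sum⟩ n i
  refine ⟨key, ?_⟩
  have h := tendsto_pi_nhds.1 key
  convert ((h 0).add (h 1)).add (h 2) using 2
  simp [pi']
  norm_num
end

section
/- Let M be the 4×4 real matrix M = [[1/4,1/4,1/2,0],[1/16,5/16,5/8,0],[3/32,7/32,7/16,1/4],[1/8,1/8,1/4,1/2]], let ν₀ = (1/4, 1/4, 1/2, 0), and let P be a probability measure on Ω = ℕ → Fin 4 such that for every n ∈ ℕ and all s₀, …, s_n ∈ Fin 4, P({ω : ω i = s_i for all i ≤ n}) = ν₀(s₀) · Π_{i<n} M(s_i, s_{i+1}). Then for P-almost every ω, for every state s ∈ Fin 4 the fraction (1/n)·|{i < n : ω i = s}| converges to π s as n → ∞, where π = (1/9, 2/9, 4/9, 2/9); in particular, (1/n)·|{i < n : ω i ≠ 3}| converges to 7/9 P-almost surely. -/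
open Matrix Filter MeasureTheory

/-- Initial distribution of the state chain. -/
noncomputable def ν₀ : Fin 4 → ℝ := ![1/4, 1/4, 1/2, 0]

section MarkovChain

variable {S : Type*} [Fintype S]

/-- The total weight of the paths of length `n` is at most geometric in `n` when every row sum of
the edge weights is at most `r`. -/
lemma sum_path_weight_le (a : S → ℝ) (W : S → S → ℝ) (r : ℝ) (ha : ∀ s, 0 ≤ a s)
    (hW : ∀ s t, 0 ≤ W s t) (hr : ∀ s, ∑ t, W s t ≤ r) (n : ℕ) :
    ∑ x : Fin (n + 1) → S, a (x 0) * ∏ i : Fin n, W (x i.castSucc) (x i.succ) ≤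
      (∑ s, a s) * r ^ n := by
  induction n with
  | zero =>
    rw [← (Equiv.funUnique (Fin 1) S).symm.sum_comp]
    simp
  | succ n ih =>
    by_cases hS : Nonempty S
    swap
    · rw [not_nonempty_iff] at hS
      simp
    obtain ⟨s₀⟩ := hS
    have hr0 : 0 ≤ r := (Finset.sum_nonneg fun t _ => hW s₀ t).trans (hr s₀)
    rw [← (Fin.snocEquiv fun _ => S).sum_comp, Fintype.sum_prod_type_right]
    calc _ = ∑ x : Fin (n + 1) → S, (a (x 0) * ∏ i : Fin n, W (x i.castSucc) (x i.succ)) *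
          ∑ t, W (x (Fin.last n)) t := by
          refine Finset.sum_congr rfl fun x _ => ?_
          rw [Finset.mul_sum]
          refine Finset.sum_congr rfl fun t _ => ?_
          have h0 : (Fin.snoc x t : Fin (n + 2) → S) 0 = x 0 :=
            Fin.snoc_castSucc (α := fun _ => S) t x 0
          have hs (i : Fin n) : (Fin.snoc x t : Fin (n + 2) → S) i.castSucc.succ = x i.succ :=
            Fin.snoc_castSucc (α := fun _ => S) t x i.succ
          simp only [Fin.snocEquiv, Equiv.coe_fn_mk, Fin.prod_univ_castSucc, h0, hs,
            Fin.snoc_castSucc, Fin.succ_last, Fin.snoc_last, mul_assoc]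
      _ ≤ ∑ x : Fin (n + 1) → S, (a (x 0) * ∏ i : Fin n, W (x i.castSucc) (x i.succ)) * r :=
          Finset.sum_le_sum fun x _ => mul_le_mul_of_nonneg_left (hr _)
            (mul_nonneg (ha _) (Finset.prod_nonneg fun i _ => hW _ _))
      _ ≤ _ := by
          rw [← Finset.sum_mul, pow_succ, ← mul_assoc]
          exact mul_le_mul_of_nonneg_right ih hr0

/-- Exponential tilting makes a stochastic matrix strictly contracting when the increments `d`
have mean zero along each row. -/
lemma exists_tilted_row_sum_le (K d : S → S → ℝ) (hK : ∀ s t, 0 ≤ K s t)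
    (hK1 : ∀ s, ∑ t, K s t = 1) (hd : ∀ s, ∑ t, K s t * d s t = 0) {ε : ℝ} (hε : 0 < ε) :
    ∃ l > 0, ∃ r, 0 ≤ r ∧ r < 1 ∧ ∀ s, ∑ t, K s t * Real.exp (l * (d s t - ε)) ≤ r := by
  set C : ℝ := 1 + ∑ s, ∑ t, |d s t| with hC
  have hC1 : 1 ≤ C :=
    le_add_of_nonneg_right (Finset.sum_nonneg fun s _ => Finset.sum_nonneg fun t _ => abs_nonneg _)
  have hdC (s t) : |d s t| ≤ C := by
    have h1 : |d s t| ≤ ∑ t, |d s t| :=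
      Finset.single_le_sum (f := fun t => |d s t|) (fun t _ => abs_nonneg _) (Finset.mem_univ t)
    have h2 : ∑ t, |d s t| ≤ ∑ s, ∑ t, |d s t| :=
      Finset.single_le_sum (f := fun s => ∑ t, |d s t|)
        (fun s _ => Finset.sum_nonneg fun t _ => abs_nonneg _) (Finset.mem_univ s)
    linarith
  set l : ℝ := min ε 1 / (2 * C ^ 2) with hl
  have hl0 : 0 < l := by positivity
  have hlC2 : l * C ^ 2 = min ε 1 / 2 := by rw [hl]; field_simp
  have hlC : l * C ≤ 1 := by
    have : l * C ≤ l * C ^ 2 := by gcongr; nlinarith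
    linarith [min_le_right ε 1]
  refine ⟨l, hl0, Real.exp (l * (l * C ^ 2 - ε)), (Real.exp_pos _).le, ?_, fun s => ?_⟩
  · rw [Real.exp_lt_one_iff]
    exact mul_neg_of_pos_of_neg hl0 (by linarith [min_le_left ε 1])
  · have hexp (t) : Real.exp (l * d s t) ≤ 1 + l * d s t + l ^ 2 * C ^ 2 := by
      have hab : |l * d s t| ≤ l * C := by
        rw [abs_mul, abs_of_pos hl0]
        exact mul_le_mul_of_nonneg_left (hdC s t) hl0.le
      have h1 := (abs_le.1 (Real.abs_exp_sub_one_sub_id_le (hab.trans hlC))).2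
      have h2 : (l * d s t) ^ 2 ≤ (l * C) ^ 2 := sq_le_sq' (abs_le.1 hab).1 (abs_le.1 hab).2
      nlinarith
    calc ∑ t, K s t * Real.exp (l * (d s t - ε))
        = (∑ t, K s t * Real.exp (l * d s t)) * Real.exp (-(l * ε)) := by
          rw [Finset.sum_mul]
          refine Finset.sum_congr rfl fun t _ => ?_
          rw [mul_assoc, ← Real.exp_add]
          ring_nf
      _ ≤ (∑ t, K s t * (1 + l * d s t + l ^ 2 * C ^ 2)) * Real.exp (-(l * ε)) := by
          gcongr with t
          · exact hK s t
          · exact hexp t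
      _ = (l ^ 2 * C ^ 2 + 1) * Real.exp (-(l * ε)) := by
          congr 1
          calc _ = (∑ t, K s t) * (1 + l ^ 2 * C ^ 2) + l * ∑ t, K s t * d s t := by
                rw [Finset.sum_mul, Finset.mul_sum, ← Finset.sum_add_distrib]
                exact Finset.sum_congr rfl fun t _ => by ring
            _ = _ := by rw [hK1, hd]; ring
      _ ≤ Real.exp (l ^ 2 * C ^ 2) * Real.exp (-(l * ε)) := by
          gcongr
          exact Real.add_one_le_exp _
      _ = Real.exp (l * (l * C ^ 2 - ε)) := by
          rw [← Real.exp_add]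
          ring_nf

variable [MeasurableSpace S] {P : Measure (ℕ → S)} {ν : S → ℝ} {K : S → S → ℝ}

/-- Union bound over the cylinders of length `n + 1`. -/
lemma measure_path_event_le (hν : ∀ s, 0 ≤ ν s) (hK : ∀ s t, 0 ≤ K s t)
    (hP : ∀ (n : ℕ) (s : ℕ → S), P {ω | ∀ i ≤ n, ω i = s i} =
      ENNReal.ofReal (ν (s 0) * ∏ i ∈ Finset.range n, K (s i) (s (i + 1))))
    (n : ℕ) (Q : (Fin (n + 1) → S) → Prop) [DecidablePred Q] :
    P {ω | Q fun i => ω i} ≤ ENNReal.ofReal (∑ x : Fin (n + 1) → S with Q x,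
      ν (x 0) * ∏ i : Fin n, K (x i.castSucc) (x i.succ)) := by
  rw [ENNReal.ofReal_sum_of_nonneg fun x _ =>
    mul_nonneg (hν _) (Finset.prod_nonneg fun i _ => hK _ _)]
  have hcyl (x : Fin (n + 1) → S) : P {ω | ∀ i : Fin (n + 1), ω i = x i} =
      ENNReal.ofReal (ν (x 0) * ∏ i : Fin n, K (x i.castSucc) (x i.succ)) := by
    have h := hP n fun i => x (Fin.ofNat (n + 1) i)
    have hx (i : Fin (n + 1)) : Fin.ofNat (n + 1) i = i := by
      ext
      simp
    rw [Finset.prod_range] at h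
    convert h using 2
    · ext ω
      refine ⟨fun H i hi => ?_, fun H i => ?_⟩
      · simpa [← hx ⟨i, Nat.lt_succ_of_le hi⟩] using H ⟨i, Nat.lt_succ_of_le hi⟩
      · simpa only [hx] using H i (Nat.le_of_lt_succ i.isLt)
    · congr 1
      refine Finset.prod_congr rfl fun i _ => ?_
      have h1 := hx i.castSucc
      have h2 := hx i.succ
      simp only [Fin.val_castSucc, Fin.val_succ] at h1 h2
      rw [h1, h2]
  calc P {ω | Q fun i => ω i}
      ≤ P (⋃ x ∈ Finset.univ.filter Q, {ω | ∀ i : Fin (n + 1), ω i = x i}) := by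
        refine measure_mono fun ω hω => ?_
        simp only [Set.mem_iUnion]
        exact ⟨fun i => ω i, Finset.mem_filter.2 ⟨Finset.mem_univ _, hω⟩, fun i => rfl⟩
    _ ≤ _ := (measure_biUnion_finset_le _ _).trans_eq (Finset.sum_congr rfl fun x _ => hcyl x)

/-- Large-deviation bound and Borel–Cantelli for the additive functional with increments `d`. -/
lemma ae_eventually_sum_increments_lt (hν : ∀ s, 0 ≤ ν s) (hK : ∀ s t, 0 ≤ K s t)
    (hK1 : ∀ s, ∑ t, K s t = 1)
    (hP : ∀ (n : ℕ) (s : ℕ → S), P {ω | ∀ i ≤ n, ω i = s i} =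
      ENNReal.ofReal (ν (s 0) * ∏ i ∈ Finset.range n, K (s i) (s (i + 1))))
    (d : S → S → ℝ) (hd : ∀ s, ∑ t, K s t * d s t = 0) {ε : ℝ} (hε : 0 < ε) :
    ∀ᵐ ω ∂P, ∀ᶠ n : ℕ in atTop, ∑ i ∈ Finset.range n, d (ω i) (ω (i + 1)) < n * ε := by
  classical
  obtain ⟨l, hl, r, hr0, hr1, hr⟩ := exists_tilted_row_sum_le K d hK hK1 hd hε
  have hbound (n : ℕ) : P {ω | n * ε ≤ ∑ i ∈ Finset.range n, d (ω i) (ω (i + 1))} ≤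
      ENNReal.ofReal ((∑ s, ν s) * r ^ n) := by
    have h := measure_path_event_le hν hK hP n
      fun x => n * ε ≤ ∑ i : Fin n, d (x i.castSucc) (x i.succ)
    simp only [Fin.val_castSucc, Fin.val_succ] at h
    simp only [Finset.sum_range]
    refine h.trans (ENNReal.ofReal_le_ofReal ?_)
    refine le_trans ?_ (sum_path_weight_le ν (fun s t => K s t * Real.exp (l * (d s t - ε))) r hν
      (fun s t => mul_nonneg (hK s t) (Real.exp_pos _).le) hr n)
    refine (Finset.sum_le_sum fun x hx => ?_).trans
      (Finset.sum_le_sum_of_subset_of_nonneg (Finset.filter_subset _ _) fun x _ _ =>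
        mul_nonneg (hν _) (Finset.prod_nonneg fun i _ =>
          mul_nonneg (hK _ _) (Real.exp_pos _).le))
    rw [Finset.prod_mul_distrib, ← Real.exp_sum, ← Finset.mul_sum, ← mul_assoc]
    refine le_mul_of_one_le_right
      (mul_nonneg (hν _) (Finset.prod_nonneg fun i _ => hK _ _)) (Real.one_le_exp ?_)
    refine mul_nonneg hl.le ?_
    simpa [Finset.sum_sub_distrib] using (Finset.mem_filter.1 hx).2
  have hsum : ∑' n : ℕ, P {ω | n * ε ≤ ∑ i ∈ Finset.range n, d (ω i) (ω (i + 1))} ≠ ⊤ := by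
    refine ne_top_of_le_ne_top ?_ (ENNReal.tsum_le_tsum hbound)
    exact ((summable_geometric_of_lt_one hr0 hr1).mul_left _).tsum_ofReal_ne_top
  filter_upwards [ae_eventually_notMem hsum] with ω hω
  filter_upwards [hω] with n hn
  simpa using hn

/-- Averages of conditionally centred increments of a finite Markov chain vanish almost surely. -/
lemma ae_tendsto_average_increments (hν : ∀ s, 0 ≤ ν s) (hK : ∀ s t, 0 ≤ K s t)
    (hK1 : ∀ s, ∑ t, K s t = 1)
    (hP : ∀ (n : ℕ) (s : ℕ → S), P {ω | ∀ i ≤ n, ω i = s i} =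
      ENNReal.ofReal (ν (s 0) * ∏ i ∈ Finset.range n, K (s i) (s (i + 1))))
    (d : S → S → ℝ) (hd : ∀ s, ∑ t, K s t * d s t = 0) :
    ∀ᵐ ω ∂P, Tendsto (fun n : ℕ => (∑ i ∈ Finset.range n, d (ω i) (ω (i + 1))) / (n : ℝ))
      atTop (nhds 0) := by
  have hpos (k : ℕ) : (0 : ℝ) < 1 / (k + 1) := Nat.one_div_pos_of_nat
  have hup := ae_all_iff.2 fun k =>
    ae_eventually_sum_increments_lt hν hK hK1 hP d hd (hpos k)
  have hlow := ae_all_iff.2 fun k =>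
    ae_eventually_sum_increments_lt hν hK hK1 hP (fun s t => -d s t)
      (fun s => by simp [hd]) (hpos k)
  filter_upwards [hup, hlow] with ω h1 h2
  rw [Metric.tendsto_nhds]
  intro ε hε
  obtain ⟨k, hk⟩ := exists_nat_one_div_lt hε
  filter_upwards [h1 k, h2 k, eventually_gt_atTop 0] with n hn1 hn2 hn
  have hn' : (0 : ℝ) < n := Nat.cast_pos.2 hn
  rw [Finset.sum_neg_distrib] at hn2
  rw [Real.dist_0_eq_abs, abs_div, abs_of_pos hn', div_lt_iff₀ hn', abs_lt]
  constructor <;> nlinarith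

/-- Strong law of large numbers for a finite Markov chain, for an observable `f` whose centring
`f - c` admits a solution `g` of the Poisson equation. -/
theorem ae_tendsto_average_of_poisson (hν : ∀ s, 0 ≤ ν s) (hK : ∀ s t, 0 ≤ K s t)
    (hK1 : ∀ s, ∑ t, K s t = 1)
    (hP : ∀ (n : ℕ) (s : ℕ → S), P {ω | ∀ i ≤ n, ω i = s i} =
      ENNReal.ofReal (ν (s 0) * ∏ i ∈ Finset.range n, K (s i) (s (i + 1))))
    (f g : S → ℝ) (c : ℝ) (hg : ∀ s, f s - c = g s - ∑ t, K s t * g t) :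
    ∀ᵐ ω ∂P, Tendsto (fun n : ℕ => (∑ i ∈ Finset.range n, f (ω i)) / (n : ℝ))
      atTop (nhds c) := by
  have hmain := ae_tendsto_average_increments hν hK hK1 hP (fun s t => g t - ∑ u, K s u * g u)
    fun s => by simp [mul_sub, Finset.sum_sub_distrib, ← Finset.sum_mul, hK1]
  filter_upwards [hmain] with ω hω
  have hbdd : Tendsto (fun n : ℕ => (g (ω 0) - g (ω n)) / (n : ℝ)) atTop (nhds 0) := by
    refine squeeze_zero_norm (a := fun n : ℕ => (2 * ∑ s, |g s|) / (n : ℝ)) (fun n => ?_)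
      (tendsto_const_div_atTop_nhds_zero_nat _)
    have hle (s : S) : |g s| ≤ ∑ s, |g s| :=
      Finset.single_le_sum (f := fun s => |g s|) (fun _ _ => abs_nonneg _) (Finset.mem_univ s)
    rw [Real.norm_eq_abs, abs_div, Nat.abs_cast]
    gcongr
    linarith [abs_sub (g (ω 0)) (g (ω n)), hle (ω 0), hle (ω n)]
  have hlim := (hω.add hbdd).add_const c
  rw [add_zero, zero_add] at hlim
  refine hlim.congr' ?_
  filter_upwards [eventually_gt_atTop 0] with n hn
  have hn' : (n : ℝ) ≠ 0 := Nat.cast_ne_zero.2 hn.ne'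
  have hsum : ∑ i ∈ Finset.range n, f (ω i) = ∑ i ∈ Finset.range n,
      (g (ω (i + 1)) - ∑ u, K (ω i) u * g u) + (g (ω 0) - g (ω n)) + n * c := by
    rw [← neg_sub (g (ω n)), ← Finset.sum_range_sub fun i => g (ω i), ← Finset.sum_neg_distrib,
      ← Finset.sum_add_distrib, ← nsmul_eq_mul, ← Finset.card_range n, ← Finset.sum_const,
      Finset.card_range, ← Finset.sum_add_distrib]
    exact Finset.sum_congr rfl fun i _ => by linarith [hg (ω i)]
  rw [hsum]
  field_simp

end MarkovChain

/-- Row `s` solves the Poisson equation for the chain `M` and the indicator of the state `s`. -/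
noncomputable def poissonSolution : Fin 4 → Fin 4 → ℝ :=
  ![![10/9, -1/9, -1/18, 0], ![2/9, 23/18, 5/36, 0], ![4/9, 5/9, 23/18, 0],
    ![-16/9, -31/18, -49/36, 0]]

lemma poissonSolution_spec (s x : Fin 4) :
    (if x = s then 1 else 0) - pi' s =
      poissonSolution s x - ∑ y, M x y * poissonSolution s y := by
  fin_cases s <;> fin_cases x <;>
    norm_num [poissonSolution, pi', M, Fin.sum_univ_succ, Fin.ext_iff]

theorem stmt6 (P : Measure (ℕ → Fin 4)) [IsProbabilityMeasure P]
    (hP : ∀ (n : ℕ) (s : ℕ → Fin 4),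
      P {ω | ∀ i ≤ n, ω i = s i} =
        ENNReal.ofReal (ν₀ (s 0) * ∏ i ∈ Finset.range n, M (s i) (s (i + 1)))) :
    ∀ᵐ ω ∂P,
      (∀ s : Fin 4,
        Tendsto
          (fun n : ℕ =>
            ((Finset.range n).filter (fun i => ω i = s)).card / (n : ℝ))
          atTop (nhds (pi' s))) ∧
      Tendsto
        (fun n : ℕ =>
          ((Finset.range n).filter (fun i => ω i ≠ 3)).card / (n : ℝ))
        atTop (nhds (7 / 9)) := by
  have hν : ∀ s, 0 ≤ ν₀ s := by
    intro s
    fin_cases s <;> norm_num [ν₀]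
  have hM : ∀ s t, 0 ≤ M s t := by
    intro s t
    fin_cases s <;> fin_cases t <;> norm_num [M]
  have hM1 : ∀ s, ∑ t, M s t = 1 := by
    intro s
    fin_cases s <;> norm_num [M, Fin.sum_univ_succ]
  have hfreq := ae_all_iff.2 fun s : Fin 4 => ae_tendsto_average_of_poisson hν hM hM1 hP
    (fun x => if x = s then 1 else 0) (poissonSolution s) (pi' s) (poissonSolution_spec s)
  filter_upwards [hfreq] with ω hω
  simp only [Finset.sum_boole] at hω
  refine ⟨hω, ?_⟩
  have hlim := (hω 3).const_sub 1
  rw [show pi' 3 = 2 / 9 from rfl, show (1 : ℝ) - 2 / 9 = 7 / 9 by norm_num] at hlim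
  refine hlim.congr' ?_
  filter_upwards [eventually_gt_atTop 0] with n hn
  have hn' : (n : ℝ) ≠ 0 := Nat.cast_ne_zero.2 hn.ne'
  have hcard := Finset.card_filter_add_card_filter_not (s := Finset.range n) fun i => ω i = 3
  rw [Finset.card_range] at hcard
  rw [eq_div_iff hn', sub_mul, div_mul_cancel₀ _ hn', one_mul, sub_eq_iff_eq_add']
  exact_mod_cast hcard.symm
end

section
/- Let M be the 4×4 real matrix M = [[1/4,1/4,1/2,0],[1/16,5/16,5/8,0],[3/32,7/32,7/16,1/4],[1/8,1/8,1/4,1/2]], let ν₀ = (1/4, 1/4, 1/2, 0), and let P be a probability measure on Ω = ℕ → Fin 4 such that for every n ∈ ℕ and all s₀, …, s_n ∈ Fin 4, P({ω : ω i = s_i for all i ≤ n}) = ν₀(s₀) · Π_{i<n} M(s_i, s_{i+1}). Then for every ε > 0 there exist C > 0 and N ∈ ℕ such that for all n ≥ N, P({ω : |(1/n)·|{i < n : ω i ≠ 3}| − 7/9| ≥ ε}) ≤ exp(−C·n). -/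
open Matrix Filter MeasureTheory

/-- The weight of a finite word under a Markov chain with initial weights `ν` and transition
matrix `Q`. -/
def wordWeight {α : Type*} (ν : α → ℝ) (Q : Matrix α α ℝ) (n : ℕ) (s : Fin (n + 1) → α) : ℝ :=
  ν (s 0) * ∏ i : Fin n, Q (s i.castSucc) (s i.succ)

/-- The exponential moment, at parameter `θ`, of the additive functional `∑ i < n, f (s i)`
corrected by the boundary term `g (s n)`. -/
noncomputable def expMoment {α : Type*} [Fintype α] (ν : α → ℝ) (Q : Matrix α α ℝ)
    (f g : α → ℝ) (θ : ℝ) (n : ℕ) : ℝ :=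
  ∑ s : Fin (n + 1) → α, wordWeight ν Q n s *
    Real.exp (θ * (∑ i : Fin n, f (s i.castSucc) + g (s (Fin.last n))))

section MarkovChain

variable {α : Type*} {ν : α → ℝ} {Q : Matrix α α ℝ}

lemma wordWeight_nonneg (hν : ∀ x, 0 ≤ ν x) (hQ : ∀ x y, 0 ≤ Q x y) (n : ℕ)
    (s : Fin (n + 1) → α) : 0 ≤ wordWeight ν Q n s :=
  mul_nonneg (hν _) (Finset.prod_nonneg fun _ _ => hQ _ _)

lemma wordWeight_snoc (n : ℕ) (s : Fin (n + 1) → α) (y : α) :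
    wordWeight ν Q (n + 1) (Fin.snoc (α := fun _ => α) s y) =
      wordWeight ν Q n s * Q (s (Fin.last n)) y := by
  have h0 : Fin.snoc (α := fun _ => α) s y 0 = s 0 := by
    rw [← Fin.castSucc_zero, Fin.snoc_castSucc]
  simp only [wordWeight, Fin.prod_univ_castSucc, h0, Fin.snoc_castSucc, Fin.succ_last,
    Fin.snoc_last, ← Fin.castSucc_succ]
  ring

/-- One step of the exponential bound: the increments `f x + g y - g x` are centred under
`Q x ·` by the Poisson equation. -/
lemma sum_mul_exp_le [Fintype α] (hQ : ∀ x y, 0 ≤ Q x y) (hQ1 : ∀ x, ∑ y, Q x y = 1)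
    {f g : α → ℝ} (hfg : ∀ x, f x + ∑ y, Q x y * g y = g x) {D θ : ℝ} (hθ : 0 ≤ θ)
    (hD : ∀ x y, |f x + g y - g x| ≤ D) (hθD : θ * D ≤ 1) (x : α) :
    ∑ y, Q x y * Real.exp (θ * (f x + g y - g x)) ≤ Real.exp (θ ^ 2 * D ^ 2) := by
  have hle (y : α) : Real.exp (θ * (f x + g y - g x)) ≤
      1 + θ * (f x + g y - g x) + θ ^ 2 * D ^ 2 := by
    have hab : |θ * (f x + g y - g x)| ≤ θ * D := by
      rw [abs_mul, abs_of_nonneg hθ]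
      exact mul_le_mul_of_nonneg_left (hD x y) hθ
    have h1 := (abs_le.mp (Real.abs_exp_sub_one_sub_id_le (hab.trans hθD))).2
    have h2 : (θ * (f x + g y - g x)) ^ 2 ≤ (θ * D) ^ 2 :=
      sq_le_sq' (abs_le.mp hab).1 (abs_le.mp hab).2
    nlinarith
  calc ∑ y, Q x y * Real.exp (θ * (f x + g y - g x))
      ≤ ∑ y, Q x y * (1 + θ * (f x + g y - g x) + θ ^ 2 * D ^ 2) :=
        Finset.sum_le_sum fun y _ => mul_le_mul_of_nonneg_left (hle y) (hQ x y)
    _ = ∑ y, (Q x y * (1 + θ * (f x - g x) + θ ^ 2 * D ^ 2) + θ * (Q x y * g y)) :=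
        Finset.sum_congr rfl fun y _ => by ring
    _ = θ ^ 2 * D ^ 2 + 1 := by
        rw [Finset.sum_add_distrib, ← Finset.sum_mul, ← Finset.mul_sum, hQ1]
        linear_combination θ * hfg x
    _ ≤ Real.exp (θ ^ 2 * D ^ 2) := Real.add_one_le_exp _

lemma expMoment_succ_le [Fintype α] (hν : ∀ x, 0 ≤ ν x) (hQ : ∀ x y, 0 ≤ Q x y)
    (hQ1 : ∀ x, ∑ y, Q x y = 1)
    {f g : α → ℝ} (hfg : ∀ x, f x + ∑ y, Q x y * g y = g x) {D θ : ℝ} (hθ : 0 ≤ θ)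
    (hD : ∀ x y, |f x + g y - g x| ≤ D) (hθD : θ * D ≤ 1) (n : ℕ) :
    expMoment ν Q f g θ (n + 1) ≤ Real.exp (θ ^ 2 * D ^ 2) * expMoment ν Q f g θ n := by
  unfold expMoment
  rw [← (Fin.snocEquiv fun _ : Fin (n + 2) => α).sum_comp, Fintype.sum_prod_type_right,
    Finset.mul_sum]
  refine Finset.sum_le_sum fun s _ => ?_
  have hstep (y : α) : wordWeight ν Q (n + 1) (Fin.snoc (α := fun _ => α) s y) *
      Real.exp (θ * (∑ i : Fin (n + 1), f (Fin.snoc (α := fun _ => α) s y i.castSucc) +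
        g (Fin.snoc (α := fun _ => α) s y (Fin.last (n + 1))))) =
      wordWeight ν Q n s *
        Real.exp (θ * (∑ i : Fin n, f (s i.castSucc) + g (s (Fin.last n)))) *
        (Q (s (Fin.last n)) y *
          Real.exp (θ * (f (s (Fin.last n)) + g y - g (s (Fin.last n))))) := by
    simp only [wordWeight_snoc, Fin.snoc_castSucc, Fin.snoc_last]
    rw [Fin.sum_univ_castSucc, mul_mul_mul_comm, ← Real.exp_add]
    congr 2
    ring
  refine (Finset.sum_congr rfl fun y _ => hstep y).trans_le ?_
  rw [← Finset.mul_sum, mul_comm]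
  exact mul_le_mul_of_nonneg_right (sum_mul_exp_le hQ hQ1 hfg hθ hD hθD _)
    (mul_nonneg (wordWeight_nonneg hν hQ n s) (Real.exp_pos _).le)

lemma expMoment_le [Fintype α] (hν : ∀ x, 0 ≤ ν x) (hν1 : ∑ x, ν x = 1)
    (hQ : ∀ x y, 0 ≤ Q x y) (hQ1 : ∀ x, ∑ y, Q x y = 1)
    {f g : α → ℝ} (hfg : ∀ x, f x + ∑ y, Q x y * g y = g x) {D θ : ℝ} (hθ : 0 ≤ θ)
    (hD : ∀ x y, |f x + g y - g x| ≤ D) (hg : ∀ x, |g x| ≤ D) (hθD : θ * D ≤ 1) (n : ℕ) :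
    expMoment ν Q f g θ n ≤ Real.exp (n * (θ ^ 2 * D ^ 2) + θ * D) := by
  induction n with
  | zero =>
    unfold expMoment wordWeight
    rw [← (Equiv.funUnique (Fin 1) α).symm.sum_comp]
    simp only [Finset.univ_eq_empty, Finset.prod_empty, Finset.sum_empty, mul_one, zero_add,
      Nat.cast_zero, zero_mul]
    calc _ ≤ ∑ x, ν x * Real.exp (θ * D) := Finset.sum_le_sum fun x _ =>
          mul_le_mul_of_nonneg_left (Real.exp_le_exp.mpr
            (mul_le_mul_of_nonneg_left ((le_abs_self _).trans (hg x)) hθ)) (hν x)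
      _ = Real.exp (θ * D) := by rw [← Finset.sum_mul, hν1, one_mul]
  | succ n ih =>
    refine (expMoment_succ_le hν hQ hQ1 hfg hθ hD hθD n).trans
      ((mul_le_mul_of_nonneg_left ih (Real.exp_pos _).le).trans_eq ?_)
    rw [← Real.exp_add]
    congr 1
    push_cast
    ring

lemma measure_cylinder_eq [MeasurableSpace α] {P : Measure (ℕ → α)}
    (hP : ∀ (n : ℕ) (s : ℕ → α), P {ω | ∀ i ≤ n, ω i = s i} =
      ENNReal.ofReal (ν (s 0) * ∏ i ∈ Finset.range n, Q (s i) (s (i + 1))))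
    (n : ℕ) (s : Fin (n + 1) → α) :
    P {ω | (fun i : Fin (n + 1) => ω i) = s} = ENNReal.ofReal (wordWeight ν Q n s) := by
  have hval (i : Fin (n + 1)) : Fin.ofNat (n + 1) (i : ℕ) = i := Fin.ofNat_val_eq_self i
  have hset : {ω : ℕ → α | (fun i : Fin (n + 1) => ω i) = s} =
      {ω | ∀ i ≤ n, ω i = s (Fin.ofNat (n + 1) i)} := by
    ext ω
    simp only [Set.mem_ofPred_eq, funext_iff]
    refine ⟨fun h i hi => ?_, fun h i => ?_⟩
    · exact (h ⟨i, Nat.lt_succ_of_le hi⟩).trans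
        (congrArg s (hval ⟨i, Nat.lt_succ_of_le hi⟩).symm)
    · rw [h i (Nat.le_of_lt_succ i.2), hval]
  rw [hset, hP n fun i => s (Fin.ofNat (n + 1) i), wordWeight,
    Finset.prod_range fun i => Q (s (Fin.ofNat (n + 1) i)) (s (Fin.ofNat (n + 1) (i + 1)))]
  congr 2
  refine Finset.prod_congr rfl fun i _ => ?_
  have h1 := hval i.castSucc
  have h2 := hval i.succ
  rw [Fin.val_castSucc] at h1
  rw [Fin.val_succ] at h2
  rw [h1, h2]

/-- Chernoff bound for additive functionals of a finite Markov chain. -/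
lemma measure_le_expMoment [Fintype α] [MeasurableSpace α] {P : Measure (ℕ → α)}
    (hν : ∀ x, 0 ≤ ν x) (hQ : ∀ x y, 0 ≤ Q x y)
    (hP : ∀ (n : ℕ) (s : ℕ → α), P {ω | ∀ i ≤ n, ω i = s i} =
      ENNReal.ofReal (ν (s 0) * ∏ i ∈ Finset.range n, Q (s i) (s (i + 1))))
    {f g : α → ℝ} {D θ : ℝ} (hθ : 0 ≤ θ) (hg : ∀ x, |g x| ≤ D) (a : ℝ) (n : ℕ) :
    P {ω | a ≤ ∑ i ∈ Finset.range n, f (ω i)} ≤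
      ENNReal.ofReal (Real.exp (θ * (D - a)) * expMoment ν Q f g θ n) := by
  classical
  set A : Finset (Fin (n + 1) → α) := {s | a ≤ ∑ i : Fin n, f (s i.castSucc)} with hA
  have hsub : {ω : ℕ → α | a ≤ ∑ i ∈ Finset.range n, f (ω i)} ⊆
      ⋃ s ∈ A, {ω | (fun i : Fin (n + 1) => ω i) = s} := by
    intro ω hω
    rw [Set.mem_ofPred_eq, Finset.sum_range fun i => f (ω i)] at hω
    simp only [Set.mem_iUnion, Set.mem_ofPred_eq, exists_prop, exists_eq_right', hA,
      Finset.mem_filter, Finset.mem_univ, true_and, Fin.val_castSucc]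
    exact hω
  have hw := wordWeight_nonneg hν hQ n
  calc P {ω | a ≤ ∑ i ∈ Finset.range n, f (ω i)}
      ≤ ∑ s ∈ A, P {ω | (fun i : Fin (n + 1) => ω i) = s} :=
        (measure_mono hsub).trans (measure_biUnion_finset_le _ _)
    _ = ENNReal.ofReal (∑ s ∈ A, wordWeight ν Q n s) := by
        rw [ENNReal.ofReal_sum_of_nonneg fun s _ => hw s]
        exact Finset.sum_congr rfl fun s _ => measure_cylinder_eq hP n s
    _ ≤ _ := by
        refine ENNReal.ofReal_le_ofReal ?_
        rw [expMoment, Finset.mul_sum]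
        refine (Finset.sum_le_sum fun s hs => ?_).trans
          (Finset.sum_le_univ_sum_of_nonneg fun s =>
            mul_nonneg (Real.exp_pos _).le (mul_nonneg (hw s) (Real.exp_pos _).le))
        rw [mul_left_comm, ← Real.exp_add]
        refine le_mul_of_one_le_right (hw s) (Real.one_le_exp ?_)
        rw [← mul_add]
        have hs' : a ≤ ∑ i : Fin n, f (s i.castSucc) := by simpa [hA] using hs
        have := neg_le_of_abs_le (hg (s (Fin.last n)))
        exact mul_nonneg hθ (by linarith)

/-- Exponential upper tail for an additive functional `∑ f` of a finite Markov chain such that the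
Poisson equation `g - Q g = f` has a solution. -/
theorem exists_exponential_upper_tail [Fintype α] [MeasurableSpace α] {P : Measure (ℕ → α)}
    (hν : ∀ x, 0 ≤ ν x) (hν1 : ∑ x, ν x = 1)
    (hQ : ∀ x y, 0 ≤ Q x y) (hQ1 : ∀ x, ∑ y, Q x y = 1)
    (hP : ∀ (n : ℕ) (s : ℕ → α), P {ω | ∀ i ≤ n, ω i = s i} =
      ENNReal.ofReal (ν (s 0) * ∏ i ∈ Finset.range n, Q (s i) (s (i + 1))))
    {f g : α → ℝ} (hfg : ∀ x, f x + ∑ y, Q x y * g y = g x) {ε : ℝ} (hε : 0 < ε) :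
    ∃ C : ℝ, 0 < C ∧ ∀ᶠ n : ℕ in atTop,
      P {ω | ε * n ≤ ∑ i ∈ Finset.range n, f (ω i)} ≤ ENNReal.ofReal (Real.exp (-C * n)) := by
  obtain ⟨D, hD0, hD, hg⟩ : ∃ D : ℝ, 0 < D ∧ (∀ x y, |f x + g y - g x| ≤ D) ∧
      ∀ x, |g x| ≤ D := by
    obtain ⟨a, ha⟩ := (Set.finite_range fun p : α × α => |f p.1 + g p.2 - g p.1|).bddAbove
    obtain ⟨b, hb⟩ := (Set.finite_range fun x => |g x|).bddAbove
    refine ⟨max (max a b) 1, by positivity, fun x y => ?_, fun x => ?_⟩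
    · exact (ha ⟨(x, y), rfl⟩).trans ((le_max_left _ _).trans (le_max_left _ _))
    · exact (hb ⟨x, rfl⟩).trans ((le_max_right _ _).trans (le_max_left _ _))
  obtain ⟨θ, hθ0, hθD, hθε⟩ : ∃ θ : ℝ, 0 < θ ∧ θ * D ≤ 1 ∧ θ * D ^ 2 ≤ ε / 2 := by
    refine ⟨min (1 / D) (ε / 2 / D ^ 2), by positivity, ?_, ?_⟩
    · rw [← le_div_iff₀ hD0]; exact min_le_left _ _
    · rw [← le_div_iff₀ (by positivity)]; exact min_le_right _ _
  refine ⟨θ * ε / 4, by positivity, ?_⟩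
  filter_upwards [eventually_ge_atTop ⌈8 * D / ε⌉₊] with n hn
  have hn' : 8 * D ≤ n * ε := (div_le_iff₀ hε).mp (Nat.ceil_le.mp hn)
  refine (measure_le_expMoment hν hQ hP hθ0.le hg (ε * n) n).trans (ENNReal.ofReal_le_ofReal ?_)
  refine (mul_le_mul_of_nonneg_left
    (expMoment_le hν hν1 hQ hQ1 hfg hθ0.le hD hg hθD n) (Real.exp_pos _).le).trans ?_
  rw [← Real.exp_add, Real.exp_le_exp]
  have h1 := mul_le_mul_of_nonneg_left hθε (mul_nonneg n.cast_nonneg hθ0.le : 0 ≤ (n : ℝ) * θ)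
  have h2 := mul_le_mul_of_nonneg_left hn' hθ0.le
  linarith

end MarkovChain

/-- The centred indicator of the non-jump states. -/
noncomputable def nonJumpDev : Fin 4 → ℝ := ![2/9, 2/9, 2/9, -7/9]

/-- The solution of the Poisson equation for `nonJumpDev` vanishing at the jump state. -/
noncomputable def nonJumpPoisson : Fin 4 → ℝ := ![16/9, 31/18, 49/36, 0]

lemma nonJumpDev_poisson (x : Fin 4) :
    nonJumpDev x + ∑ y, M x y * nonJumpPoisson y = nonJumpPoisson x := by
  fin_cases x <;> simp [Fin.sum_univ_four, M, nonJumpDev, nonJumpPoisson] <;> norm_num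

lemma M_nonneg (x y : Fin 4) : 0 ≤ M x y := by
  fin_cases x <;> fin_cases y <;> simp [M] <;> positivity

lemma M_row_sum (x : Fin 4) : ∑ y, M x y = 1 := by
  fin_cases x <;> simp [Fin.sum_univ_four, M] <;> norm_num

lemma ν₀_nonneg (x : Fin 4) : 0 ≤ ν₀ x := by
  fin_cases x <;> simp [ν₀]

lemma ν₀_sum : ∑ x, ν₀ x = 1 := by
  simp [Fin.sum_univ_four, ν₀]; norm_num

lemma sum_nonJumpDev (ω : ℕ → Fin 4) (n : ℕ) :
    ∑ i ∈ Finset.range n, nonJumpDev (ω i) =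
      (((Finset.range n).filter (fun i => ω i ≠ 3)).card : ℝ) - 7 / 9 * n := by
  have h (x : Fin 4) : nonJumpDev x = (if x ≠ 3 then 1 else 0) - 7 / 9 := by
    fin_cases x <;> simp [nonJumpDev] <;> norm_num
  simp only [h, Finset.sum_sub_distrib, Finset.sum_boole, Finset.sum_const, Finset.card_range,
    nsmul_eq_mul]
  ring

theorem stmt7 (P : Measure (ℕ → Fin 4)) [IsProbabilityMeasure P]
    (hP : ∀ (n : ℕ) (s : ℕ → Fin 4),
      P {ω | ∀ i ≤ n, ω i = s i} =
        ENNReal.ofReal (ν₀ (s 0) * ∏ i ∈ Finset.range n, M (s i) (s (i + 1)))) :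
    ∀ ε : ℝ, 0 < ε → ∃ C : ℝ, 0 < C ∧ ∃ N : ℕ, ∀ n : ℕ, N ≤ n →
      P {ω | ε ≤
          |(((Finset.range n).filter (fun i => ω i ≠ 3)).card : ℝ) / (n : ℝ)
            - 7 / 9|} ≤
        ENNReal.ofReal (Real.exp (-C * n)) := by
  intro ε hε
  obtain ⟨C₁, hC₁, h₁⟩ := exists_exponential_upper_tail ν₀_nonneg ν₀_sum M_nonneg M_row_sum hP
    nonJumpDev_poisson hε
  obtain ⟨C₂, hC₂, h₂⟩ := exists_exponential_upper_tail ν₀_nonneg ν₀_sum M_nonneg M_row_sum hP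
    (f := fun x => -nonJumpDev x) (g := fun x => -nonJumpPoisson x)
    (fun x => by simp only [mul_neg, Finset.sum_neg_distrib]; linarith [nonJumpDev_poisson x]) hε
  set C := min C₁ C₂ with hC
  have hC0 : 0 < C := lt_min hC₁ hC₂
  refine ⟨C / 2, by positivity, ?_⟩
  rw [← eventually_atTop]
  filter_upwards [h₁, h₂, eventually_ge_atTop ⌈2 / C⌉₊, eventually_gt_atTop 0] with n hn₁ hn₂ hn hn0
  have hn0' : (0 : ℝ) < n := Nat.cast_pos.mpr hn0
  have hnC : 2 ≤ n * C := (div_le_iff₀ hC0).mp (Nat.ceil_le.mp hn)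
  have hsub : {ω : ℕ → Fin 4 | ε ≤
      |(((Finset.range n).filter (fun i => ω i ≠ 3)).card : ℝ) / (n : ℝ) - 7 / 9|} ⊆
      {ω | ε * n ≤ ∑ i ∈ Finset.range n, nonJumpDev (ω i)} ∪
      {ω | ε * n ≤ ∑ i ∈ Finset.range n, -nonJumpDev (ω i)} := by
    intro ω hω
    simp only [Set.mem_union, Set.mem_ofPred_eq, Finset.sum_neg_distrib, sum_nonJumpDev] at hω ⊢
    rw [← le_abs]
    rwa [← mul_div_cancel_right₀ (7 / 9 : ℝ) hn0'.ne', ← sub_div, abs_div,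
      abs_of_pos hn0', le_div_iff₀ hn0'] at hω
  have hexp {c : ℝ} (hc : C ≤ c) : Real.exp (-c * n) ≤ Real.exp (-C * n) :=
    Real.exp_le_exp.mpr (by nlinarith)
  refine (measure_mono hsub).trans ((measure_union_le _ _).trans ((add_le_add hn₁ hn₂).trans ?_))
  rw [← ENNReal.ofReal_add (Real.exp_pos _).le (Real.exp_pos _).le]
  refine ENNReal.ofReal_le_ofReal ?_
  have htwo : 2 ≤ Real.exp (C / 2 * n) := by
    linarith [Real.add_one_le_exp (C / 2 * n)]
  calc Real.exp (-C₁ * n) + Real.exp (-C₂ * n)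
      ≤ 2 * Real.exp (-C * n) := by
        linarith [hexp (min_le_left C₁ C₂), hexp (min_le_right C₁ C₂)]
    _ ≤ Real.exp (C / 2 * n) * Real.exp (-C * n) :=
        mul_le_mul_of_nonneg_right htwo (Real.exp_pos _).le
    _ = Real.exp (-(C / 2) * n) := by
        rw [← Real.exp_add]
        congr 1
        ring
end

section
/- There exist constants c₁ > 0 and c₂ > 0 such that for every integer n ≥ 2, c₁ · 8ⁿ / n^{3/2} ≤ Σ_{d=1}^{n−1} 2^{n−1−d} · (d/(2n−2−d)) · C(2n−2−d, n−1−d) ≤ c₂ · 8ⁿ / n^{3/2}, where C(a,b) denotes the binomial coefficient and the sum is over integers d with 1 ≤ d ≤ n−1. -/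
theorem two_mul_add_one_mul_centralBinom_sq_le (m : ℕ) :
    (2 * m + 1) * m.centralBinom ^ 2 ≤ 16 ^ m := by
  induction m with
  | zero => simp
  | succ m ih =>
    have h := Nat.succ_mul_centralBinom_succ m
    refine le_of_mul_le_mul_left (a := (m + 1) ^ 2) ?_ (by positivity)
    calc (m + 1) ^ 2 * ((2 * (m + 1) + 1) * (m + 1).centralBinom ^ 2)
        = (2 * m + 3) * ((m + 1) * (m + 1).centralBinom) ^ 2 := by ring
      _ = 4 * (2 * m + 3) * (2 * m + 1) * ((2 * m + 1) * m.centralBinom ^ 2) := by rw [h]; ring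
      _ ≤ 4 * (2 * m + 3) * (2 * m + 1) * 16 ^ m := by gcongr
      _ ≤ 16 * (m + 1) ^ 2 * 16 ^ m := Nat.mul_le_mul_right _ (by nlinarith)
      _ = (m + 1) ^ 2 * 16 ^ (m + 1) := by ring

theorem sixteen_pow_le_four_mul_mul_centralBinom_sq {m : ℕ} (hm : 1 ≤ m) :
    16 ^ m ≤ 4 * m * m.centralBinom ^ 2 := by
  induction m, hm using Nat.le_induction with
  | base => simp [Nat.centralBinom]
  | succ m hm ih =>
    have h := Nat.succ_mul_centralBinom_succ m
    refine le_of_mul_le_mul_left (a := m + 1) ?_ (by positivity)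
    calc (m + 1) * 16 ^ (m + 1) = 16 * (m + 1) * 16 ^ m := by ring
      _ ≤ 16 * (m + 1) * (4 * m * m.centralBinom ^ 2) := by gcongr
      _ = 16 * (4 * m * (m + 1)) * m.centralBinom ^ 2 := by ring
      _ ≤ 16 * (2 * m + 1) ^ 2 * m.centralBinom ^ 2 := by gcongr; nlinarith
      _ = 4 * (2 * (2 * m + 1) * m.centralBinom) ^ 2 := by ring
      _ = (m + 1) * (4 * (m + 1) * (m + 1).centralBinom ^ 2) := by rw [← h]; ring

theorem centralBinom_mul_sqrt_le {m : ℕ} :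
    (m.centralBinom : ℝ) * √(m + 1) ≤ 4 ^ m := by
  have h : (2 * m + 1) * (m.centralBinom : ℝ) ^ 2 ≤ 16 ^ m := by
    exact_mod_cast two_mul_add_one_mul_centralBinom_sq_le m
  refine (sq_le_sq₀ (by positivity) (by positivity)).1 ?_
  rw [mul_pow, Real.sq_sqrt (by positivity), ← pow_mul, mul_comm m, pow_mul]
  norm_num
  nlinarith [mul_nonneg (Nat.cast_nonneg (α := ℝ) m) (sq_nonneg (m.centralBinom : ℝ))]

theorem four_pow_le_centralBinom_mul_sqrt {m : ℕ} (hm : 1 ≤ m) :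
    (4 : ℝ) ^ m ≤ 2 * m.centralBinom * √(m + 1) := by
  have h : (16 : ℝ) ^ m ≤ 4 * m * (m.centralBinom : ℝ) ^ 2 := by
    exact_mod_cast sixteen_pow_le_four_mul_mul_centralBinom_sq hm
  refine (sq_le_sq₀ (by positivity) (by positivity)).1 ?_
  rw [mul_pow, Real.sq_sqrt (by positivity), ← pow_mul, mul_comm m, pow_mul]
  norm_num
  nlinarith [sq_nonneg (m.centralBinom : ℝ)]

theorem two_pow_mul_choose_le_centralBinom {m d : ℕ} (hd : d ≤ m) :
    2 ^ d * (2 * m - d).choose (m - d) ≤ m.centralBinom := by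
  induction d with
  | zero => simp [Nat.centralBinom]
  | succ d ih =>
    refine le_trans ?_ (ih (by omega))
    obtain ⟨k, rfl⟩ := Nat.exists_eq_add_of_le hd
    have e₁ : 2 * (d + 1 + k) - (d + 1) = d + 1 + 2 * k := by omega
    have e₂ : d + 1 + k - (d + 1) = k := by omega
    have e₃ : 2 * (d + 1 + k) - d = d + 1 + 2 * k + 1 := by omega
    have e₄ : d + 1 + k - d = k + 1 := by omega
    rw [e₁, e₂, e₃, e₄, pow_succ, mul_assoc]
    gcongr
    have h := Nat.choose_succ_right_eq (d + 1 + 2 * k) k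
    rw [show d + 1 + 2 * k - k = d + 1 + k by omega] at h
    have hle : (d + 1 + 2 * k).choose k ≤ (d + 1 + 2 * k).choose (k + 1) := by
      refine le_of_mul_le_mul_right (a := k + 1) ?_ (by positivity)
      rw [h]
      exact Nat.mul_le_mul_left _ (by omega)
    rw [Nat.choose_succ_succ']
    omega

theorem sum_Icc_div_four_pow_le (m : ℕ) :
    ∑ d ∈ Finset.Icc 1 m, (d : ℝ) / 4 ^ d ≤ 1 - (m + 1) / 4 ^ m := by
  induction m with
  | zero => simp
  | succ m ih =>
    rw [Finset.sum_Icc_succ_top (by omega)]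
    have h : (0 : ℝ) ≤ (m + 1) / 4 ^ m - (m + 2) / 4 ^ (m + 1) - (m + 1) / 4 ^ (m + 1) := by
      rw [pow_succ]
      have : ((m : ℝ) + 1) / 4 ^ m - (m + 2) / (4 ^ m * 4) - (m + 1) / (4 ^ m * 4)
          = (2 * m + 1) / (4 ^ m * 4) := by
        field_simp
        ring
      rw [this]
      positivity
    push_cast
    rw [show (m : ℝ) + 1 + 1 = m + 2 by ring]
    linarith

theorem ballot_term_le {m d : ℕ} (hm : 1 ≤ m) (hd : d ≤ m) :
    (2 : ℝ) ^ (m - d) * ((d : ℝ) / ((2 * m - d : ℕ) : ℝ)) * ((2 * m - d).choose (m - d) : ℝ) ≤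
      2 ^ m * m.centralBinom / m * (d / 4 ^ d) := by
  have hC : (2 : ℝ) ^ d * ((2 * m - d).choose (m - d) : ℝ) ≤ m.centralBinom := by
    exact_mod_cast two_pow_mul_choose_le_centralBinom hd
  have hm' : (0 : ℝ) < m := by exact_mod_cast hm
  have hle : (m : ℝ) ≤ ((2 * m - d : ℕ) : ℝ) := by exact_mod_cast (by omega : m ≤ 2 * m - d)
  have hpow : (2 : ℝ) ^ (m - d) = 2 ^ m / 2 ^ d := by
    rw [pow_sub₀ _ two_ne_zero hd, div_eq_mul_inv]
  have h4 : (4 : ℝ) ^ d = 2 ^ d * 2 ^ d := by rw [← mul_pow]; norm_num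
  calc _ ≤ (2 : ℝ) ^ (m - d) * ((d : ℝ) / m) * (m.centralBinom / 2 ^ d) := by
        gcongr
        rw [le_div_iff₀ (by positivity)]
        linarith
    _ = _ := by
        rw [hpow, h4]
        field_simp

theorem ballot_first_term {m : ℕ} (hm : 1 ≤ m) :
    (2 : ℝ) ^ (m - 1) * (((1 : ℕ) : ℝ) / ((2 * m - 1 : ℕ) : ℝ)) *
      ((2 * m - 1).choose (m - 1) : ℝ) =
      2 ^ m * m.centralBinom / (4 * (2 * m - 1)) := by
  obtain ⟨k, rfl⟩ := Nat.exists_eq_add_of_le' hm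
  have h : (k + 1).centralBinom = 2 * (2 * k + 1).choose k := by
    rw [Nat.centralBinom, show 2 * (k + 1) = 2 * k + 1 + 1 by ring, Nat.choose_succ_succ,
      Nat.choose_symm_half]
    ring
  rw [h, show 2 * (k + 1) - 1 = 2 * k + 1 by omega, Nat.add_sub_cancel]
  push_cast
  rw [show (2 : ℝ) * (k + 1) - 1 = 2 * k + 1 by ring]
  field_simp
  ring

theorem stmt9 :
    ∃ c₁ : ℝ, 0 < c₁ ∧ ∃ c₂ : ℝ, 0 < c₂ ∧
      ∀ n : ℕ, 2 ≤ n →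
        c₁ * 8 ^ n / (n : ℝ) ^ ((3 : ℝ) / 2) ≤
          (∑ d ∈ Finset.Icc 1 (n - 1),
            (2 : ℝ) ^ (n - 1 - d) * ((d : ℝ) / ((2 * n - 2 - d : ℕ) : ℝ)) *
              (Nat.choose (2 * n - 2 - d) (n - 1 - d) : ℝ)) ∧
        (∑ d ∈ Finset.Icc 1 (n - 1),
            (2 : ℝ) ^ (n - 1 - d) * ((d : ℝ) / ((2 * n - 2 - d : ℕ) : ℝ)) *
              (Nat.choose (2 * n - 2 - d) (n - 1 - d) : ℝ)) ≤
          c₂ * 8 ^ n / (n : ℝ) ^ ((3 : ℝ) / 2) := by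
  refine ⟨1 / 128, by norm_num, 1, one_pos, fun n hn => ?_⟩
  obtain ⟨m, rfl⟩ := Nat.exists_eq_add_of_le' (show 1 ≤ n by omega)
  have hm : 1 ≤ m := by omega
  have hm' : (1 : ℝ) ≤ m := by exact_mod_cast hm
  rw [Nat.add_sub_cancel, show 2 * (m + 1) - 2 = 2 * m by omega]
  have hrpow : ((m + 1 : ℕ) : ℝ) ^ ((3 : ℝ) / 2) = (m + 1) * √(m + 1) := by
    rw [show (3 : ℝ) / 2 = 1 + 1 / 2 by norm_num, Real.rpow_add (by positivity), Real.rpow_one,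
      Real.sqrt_eq_rpow]
    push_cast
    rfl
  have h8 : (8 : ℝ) ^ (m + 1) = 8 * (2 ^ m * 4 ^ m) := by
    rw [pow_succ, ← mul_pow]
    norm_num [mul_comm]
  rw [hrpow, h8]
  constructor
  · calc _ ≤ (2 : ℝ) ^ m * m.centralBinom / (4 * (2 * m - 1)) := by
          rw [div_le_div_iff₀ (by positivity) (by linarith)]
          calc 1 / 128 * (8 * ((2 : ℝ) ^ m * 4 ^ m)) * (4 * (2 * m - 1))
              = 2 ^ m * (4 ^ m) * ((2 * m - 1) / 4) := by ring
            _ ≤ 2 ^ m * (2 * m.centralBinom * √(m + 1)) * ((m + 1) / 2) := by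
                gcongr ?_ * ?_ * ?_
                · exact div_nonneg (by linarith) (by norm_num)
                · exact four_pow_le_centralBinom_mul_sqrt hm
                · linarith
            _ = _ := by ring
      _ ≤ _ := by
          rw [← ballot_first_term hm]
          exact Finset.single_le_sum (f := fun d : ℕ => (2 : ℝ) ^ (m - d) *
            ((d : ℝ) / ((2 * m - d : ℕ) : ℝ)) * ((2 * m - d).choose (m - d) : ℝ))
            (fun _ _ => by positivity) (Finset.mem_Icc.2 ⟨le_rfl, hm⟩)
  · calc _ ≤ ∑ d ∈ Finset.Icc 1 m, (2 : ℝ) ^ m * m.centralBinom / m * (d / 4 ^ d) :=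
          Finset.sum_le_sum fun d hd => ballot_term_le hm (Finset.mem_Icc.1 hd).2
      _ ≤ (2 : ℝ) ^ m * m.centralBinom / m * 1 := by
          rw [← Finset.mul_sum]
          gcongr
          exact (sum_Icc_div_four_pow_le m).trans (sub_le_self _ (by positivity))
      _ ≤ _ := by
          rw [mul_one, div_le_div_iff₀ (by positivity) (by positivity)]
          calc (2 : ℝ) ^ m * m.centralBinom * ((m + 1) * √(m + 1))
              = 2 ^ m * (m.centralBinom * √(m + 1)) * (m + 1) := by ring
            _ ≤ 2 ^ m * 4 ^ m * (8 * m) := by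
                gcongr
                · exact centralBinom_mul_sqrt_le
                · linarith
            _ = _ := by ring
end

section
/- For all integers n ≥ 2 and D with 1 ≤ D ≤ n−1, one has Σ_{d=D}^{n−1} 2^{n−1−d} · C(2n−2−d, n−1−d) ≤ 2^{3n−2−2D}, where C(a,b) denotes the binomial coefficient and the sum is over integers d with D ≤ d ≤ n−1. -/
theorem sum_Icc_two_pow_sub_two_mul_le {D m : ℕ} (h : D ≤ m) :
    ∑ d ∈ Finset.Icc D m, 2 ^ (3 * m - 2 * d) ≤ 2 ^ (3 * m + 1 - 2 * D) := by
  induction h using Nat.decreasingInduction with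
  | self =>
    rw [Finset.Icc_self, Finset.sum_singleton]
    exact Nat.pow_le_pow_right two_pos (by omega)
  | of_succ k hk ih =>
    rw [← Finset.insert_Icc_add_one_left_eq_Icc hk.le, Finset.sum_insert (by simp)]
    have h₁ : 2 ^ (3 * m + 1 - 2 * (k + 1)) ≤ 2 ^ (3 * m - 2 * k) :=
      Nat.pow_le_pow_right two_pos (by omega)
    have h₂ : 3 * m + 1 - 2 * k = 3 * m - 2 * k + 1 := by omega
    rw [h₂, pow_succ]
    omega

theorem stmt10 (n D : ℕ) (hn : 2 ≤ n) (hD1 : 1 ≤ D) (hD2 : D ≤ n - 1) :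
    ∑ d ∈ Finset.Icc D (n - 1),
        2 ^ (n - 1 - d) * Nat.choose (2 * n - 2 - d) (n - 1 - d) ≤
      2 ^ (3 * n - 2 - 2 * D) := by
  have hexp : 3 * n - 2 - 2 * D = 3 * (n - 1) + 1 - 2 * D := by omega
  rw [hexp]
  refine (Finset.sum_le_sum fun d hd => ?_).trans (sum_Icc_two_pow_sub_two_mul_le hD2)
  have hd' := (Finset.mem_Icc.mp hd).2
  calc 2 ^ (n - 1 - d) * Nat.choose (2 * n - 2 - d) (n - 1 - d)
      ≤ 2 ^ (n - 1 - d) * 2 ^ (2 * n - 2 - d) := by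
        gcongr
        exact Nat.choose_le_two_pow _ _
    _ = 2 ^ (3 * (n - 1) - 2 * d) := by
        rw [← pow_add]
        congr 1
        omega
end

section
/- Fix real numbers α > 0 and ε > 0. There exist constants C₁ > 0, C₂ > 0 and a > 0 such that for every integer n ≥ 2, the ratio (Σ_{d : α·n^ε ≤ d ≤ n−1} 2^{n−1−d} · (d/(2n−2−d)) · C(2n−2−d, n−1−d)) / (Σ_{d=1}^{n−1} 2^{n−1−d} · (d/(2n−2−d)) · C(2n−2−d, n−1−d)) is at most C₁ · exp(−C₂ · n^a), where C(a,b) denotes the binomial coefficient; here both sums range over integers d in the indicated intervals, and the ratio is interpreted as 0 if the numerator's index range is empty. -/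
open scoped Classical

/-- The number of well bicoloured plane trees with `N + 1` vertices whose rightmost branch has
length `d`, divided by `d`. -/
noncomputable def branchWeight (N d : ℕ) : ℝ :=
  2 ^ (N - d) * (Nat.choose (2 * N - d) (N - d) : ℝ) / ((2 * N - d : ℕ) : ℝ)

lemma branchWeight_nonneg (N d : ℕ) : 0 ≤ branchWeight N d := by
  unfold branchWeight
  positivity

lemma branchWeight_one_pos {N : ℕ} (hN : 1 ≤ N) : 0 < branchWeight N 1 := by
  have hchoose : 0 < Nat.choose (2 * N - 1) (N - 1) := Nat.choose_pos (by omega)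
  have hden : 0 < 2 * N - 1 := by omega
  unfold branchWeight
  positivity

lemma branchWeight_succ_le {N d : ℕ} (hd : 1 ≤ d) (hdN : d < N) :
    branchWeight N (d + 1) ≤ branchWeight N d / 4 := by
  obtain ⟨k, rfl⟩ : ∃ k, N = d + 1 + k := ⟨N - (d + 1), by omega⟩
  have hchoose : (Nat.choose (2 * k + d + 2) (k + 1) : ℝ) * (k + 1) =
      (2 * k + d + 2) * Nat.choose (2 * k + d + 1) k := by
    exact_mod_cast (Nat.add_one_mul_choose_eq (2 * k + d + 1) k).symm
  have hd' : (1 : ℝ) ≤ d := by exact_mod_cast hd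
  unfold branchWeight
  rw [show 2 * (d + 1 + k) - (d + 1) = 2 * k + d + 1 by omega,
    show d + 1 + k - (d + 1) = k by omega,
    show 2 * (d + 1 + k) - d = 2 * k + d + 2 by omega, show d + 1 + k - d = k + 1 by omega,
    eq_div_of_mul_eq (by positivity) hchoose]
  calc
    _ ≤ (2 : ℝ) ^ k * (Nat.choose (2 * k + d + 1) k : ℝ) / (2 * k + 2) := by
      push_cast
      exact div_le_div_of_nonneg_left (by positivity) (by positivity) (by linarith)
    _ = _ := by
      push_cast
      field_simp
      ring

lemma branchWeight_le {N d : ℕ} (hd : 1 ≤ d) (hdN : d ≤ N) :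
    branchWeight N d ≤ 4 * (1 / 4) ^ d * branchWeight N 1 := by
  induction d, hd using Nat.le_induction with
  | base => norm_num
  | succ d hd ih =>
    have hstep := branchWeight_succ_le hd hdN
    have hprev := ih (by omega)
    rw [pow_succ]
    linarith

lemma sum_Icc_mul_half_pow_le (N : ℕ) : ∑ d ∈ Finset.Icc 1 N, (d : ℝ) * (1 / 2) ^ d ≤ 2 := by
  have hsum : ∑ d ∈ Finset.Icc 1 N, (d : ℝ) * (1 / 2) ^ d = 2 - (N + 2) * (1 / 2) ^ N := by
    induction N with
    | zero => norm_num
    | succ N ih =>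
      rw [Finset.sum_Icc_succ_top (by omega), ih]
      push_cast
      ring
  rw [hsum]
  have : (0 : ℝ) ≤ (N + 2) * (1 / 2) ^ N := by positivity
  linarith

lemma half_pow_le_exp {x : ℝ} {d : ℕ} (h : x ≤ d) :
    (1 / 2 : ℝ) ^ d ≤ Real.exp (-(Real.log 2 * x)) := by
  have hlog : 0 < Real.log 2 := Real.log_pos (by norm_num)
  rw [← Real.rpow_natCast, Real.rpow_def_of_pos (by norm_num), one_div, Real.log_inv]
  gcongr
  nlinarith

lemma sum_branchWeight_filter_le (N : ℕ) (x : ℝ) :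
    ∑ d ∈ (Finset.Icc 1 N).filter (fun d : ℕ => x ≤ (d : ℝ)), (d : ℝ) * branchWeight N d ≤
      8 * Real.exp (-(Real.log 2 * x)) * branchWeight N 1 := by
  have hw := branchWeight_nonneg N 1
  calc
    _ ≤ ∑ d ∈ (Finset.Icc 1 N).filter (fun d : ℕ => x ≤ (d : ℝ)),
        (d : ℝ) * (1 / 2) ^ d * (4 * Real.exp (-(Real.log 2 * x)) * branchWeight N 1) := by
      refine Finset.sum_le_sum fun d hd => ?_
      obtain ⟨hmem, hx⟩ := Finset.mem_filter.1 hd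
      obtain ⟨h1, hN⟩ := Finset.mem_Icc.1 hmem
      calc
        _ ≤ (d : ℝ) * (4 * (1 / 4) ^ d * branchWeight N 1) := by
          gcongr
          exact branchWeight_le h1 hN
        _ = (d : ℝ) * (1 / 2) ^ d * (4 * (1 / 2) ^ d * branchWeight N 1) := by
          rw [show (1 / 4 : ℝ) = 1 / 2 * (1 / 2) by norm_num, mul_pow]
          ring
        _ ≤ _ := by
          gcongr
          exact half_pow_le_exp hx
    _ ≤ ∑ d ∈ Finset.Icc 1 N,
        (d : ℝ) * (1 / 2) ^ d * (4 * Real.exp (-(Real.log 2 * x)) * branchWeight N 1) :=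
      Finset.sum_le_sum_of_subset_of_nonneg (Finset.filter_subset _ _)
        fun _ _ _ => by positivity
    _ ≤ 2 * (4 * Real.exp (-(Real.log 2 * x)) * branchWeight N 1) := by
      rw [← Finset.sum_mul]
      gcongr
      exact sum_Icc_mul_half_pow_le N
    _ = _ := by ring

lemma branchWeight_one_le_sum {N : ℕ} (hN : 1 ≤ N) :
    branchWeight N 1 ≤ ∑ d ∈ Finset.Icc 1 N, (d : ℝ) * branchWeight N d := by
  simpa using Finset.single_le_sum (f := fun d : ℕ => (d : ℝ) * branchWeight N d)
    (fun d _ => mul_nonneg d.cast_nonneg (branchWeight_nonneg N d))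
    (Finset.mem_Icc.2 ⟨le_rfl, hN⟩)

theorem stmt11 (α ε : ℝ) (hα : 0 < α) (hε : 0 < ε) :
    ∃ C₁ : ℝ, 0 < C₁ ∧ ∃ C₂ : ℝ, 0 < C₂ ∧ ∃ a : ℝ, 0 < a ∧
      ∀ n : ℕ, 2 ≤ n →
        (∑ d ∈ (Finset.Icc 1 (n - 1)).filter
              (fun d : ℕ => α * (n : ℝ) ^ ε ≤ (d : ℝ)),
            (2 : ℝ) ^ (n - 1 - d) * ((d : ℝ) / ((2 * n - 2 - d : ℕ) : ℝ)) *
              (Nat.choose (2 * n - 2 - d) (n - 1 - d) : ℝ)) /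
          (∑ d ∈ Finset.Icc 1 (n - 1),
            (2 : ℝ) ^ (n - 1 - d) * ((d : ℝ) / ((2 * n - 2 - d : ℕ) : ℝ)) *
              (Nat.choose (2 * n - 2 - d) (n - 1 - d) : ℝ)) ≤
        C₁ * Real.exp (-C₂ * (n : ℝ) ^ a) := by
  refine ⟨8, by norm_num, Real.log 2 * α, mul_pos (Real.log_pos (by norm_num)) hα, ε, hε, ?_⟩
  intro n hn
  have hterm (d : ℕ) : (2 : ℝ) ^ (n - 1 - d) * ((d : ℝ) / ((2 * n - 2 - d : ℕ) : ℝ)) *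
      (Nat.choose (2 * n - 2 - d) (n - 1 - d) : ℝ) = d * branchWeight (n - 1) d := by
    rw [branchWeight, show 2 * (n - 1) - d = 2 * n - 2 - d by omega]
    ring
  simp only [hterm]
  have hN : 1 ≤ n - 1 := by omega
  have hden := branchWeight_one_le_sum hN
  rw [div_le_iff₀ ((branchWeight_one_pos hN).trans_le hden)]
  refine (sum_branchWeight_filter_le (n - 1) (α * (n : ℝ) ^ ε)).trans ?_
  rw [neg_mul, mul_assoc (Real.log 2)]
  gcongr
end
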